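/- arXiv:math/0209250 — 4 statements merged into one kernel-verified Lean document; each statement's English description precedes it below -/
import Mathlib

section
/- Let a group G act on a set M and let U ⊆ V ⊆ W ⊆ M, each equipped with the induced partial action. Then E(U) ⊆ E(V) ⊆ E(W) and F'(U) ⊆ F'(V) ⊆ F'(W); moreover the assignment on generators g ∈ E(U) ↦ class of g ∈ E(V) induces a well-defined group homomorphism ψ_U^V : 𝐆(G,U) → 𝐆(G,V) (and similarly ψ_V^W, ψ_U^W), and ψ_U^W = ψ_V^W ∘ ψ_U^V. -/
open Pointwise

/-- `E(V) = {g ∈ G : V ∩ g•V ≠ ∅}`. -/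
def Eset (G : Type*) {M : Type*} [Group G] [MulAction G M] (V : Set M) : Set G :=
  {g | (V ∩ g • V).Nonempty}

/-- `F'(V) = {(g,h) : V ∩ g•V ∩ (g*h)•V ≠ ∅}`. -/
def Fset (G : Type*) {M : Type*} [Group G] [MulAction G M] (V : Set M) : Set (G × G) :=
  {p | (V ∩ p.1 • V ∩ (p.1 * p.2) • V).Nonempty}

/-- The relators `(g)(h)((g*h))⁻¹` with `(g,h) ∈ F'(V)`. -/
def relatorSet (G : Type*) {M : Type*} [Group G] [MulAction G M] (V : Set M) :
    Set (FreeGroup ↥(Eset G V)) :=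
  {r | ∃ g h gh : ↥(Eset G V), ((g : G), (h : G)) ∈ Fset G V ∧ (gh : G) = (g : G) * h ∧
       r = FreeGroup.of g * FreeGroup.of h * (FreeGroup.of gh)⁻¹}

/-- The group `𝐆(G,V)`: the free group on `E(V)` modulo the normal closure of the relators. -/
abbrev GGrp (G : Type*) {M : Type*} [Group G] [MulAction G M] (V : Set M) : Type _ :=
  FreeGroup ↥(Eset G V) ⧸ Subgroup.normalClosure (relatorSet G V)

/-- The class of a generator `g ∈ E(V)` in `𝐆(G,V)`. -/
def GGrp.gen (G : Type*) {M : Type*} [Group G] [MulAction G M] (V : Set M)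
    (g : ↥(Eset G V)) : GGrp G V :=
  QuotientGroup.mk (FreeGroup.of g)

theorem Eset_mono {G M : Type*} [Group G] [MulAction G M] {U V : Set M} (h : U ⊆ V) :
    Eset G U ⊆ Eset G V := by
  rintro g ⟨x, hx1, hx2⟩
  exact ⟨x, h hx1, Set.smul_set_mono h hx2⟩

theorem Fset_mono {G M : Type*} [Group G] [MulAction G M] {U V : Set M} (h : U ⊆ V) :
    Fset G U ⊆ Fset G V := by
  rintro ⟨g, g'⟩ ⟨x, ⟨hx1, hx2⟩, hx3⟩
  exact ⟨x, ⟨h hx1, Set.smul_set_mono h hx2⟩, Set.smul_set_mono h hx3⟩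

/-- `ψ_U^V : 𝐆(G,U) → 𝐆(G,V)`, induced on generators by the inclusion `E(U) ⊆ E(V)`. -/
def psi (G : Type*) {M : Type*} [Group G] [MulAction G M] {U V : Set M} (hUV : U ⊆ V) :
    GGrp G U →* GGrp G V :=
  QuotientGroup.lift _
    ((QuotientGroup.mk' (Subgroup.normalClosure (relatorSet G V))).comp
      (FreeGroup.map (fun g => (⟨(g : G), Eset_mono hUV g.2⟩ : ↥(Eset G V))))) <| by
    intro x hx
    set φ := (QuotientGroup.mk' (Subgroup.normalClosure (relatorSet G V))).comp
      (FreeGroup.map (fun g : ↥(Eset G U) => (⟨(g : G), Eset_mono hUV g.2⟩ : ↥(Eset G V))))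
    have hsub : relatorSet G U ⊆ (φ.ker : Set (FreeGroup ↥(Eset G U))) := by
      rintro r ⟨g, h, gh, hF, hmul, rfl⟩
      have : φ (FreeGroup.of g * FreeGroup.of h * (FreeGroup.of gh)⁻¹) = 1 := by
        simp only [φ, MonoidHom.comp_apply, map_mul, map_inv, FreeGroup.map.of]
        apply (QuotientGroup.eq_one_iff _).mpr
        apply Subgroup.subset_normalClosure
        exact ⟨_, _, _, Fset_mono hUV hF, hmul, rfl⟩
      exact this
    exact (Subgroup.normalClosure_le_normal hsub) hx

@[simp] theorem psi_gen {G M : Type*} [Group G] [MulAction G M] {U V : Set M} (hUV : U ⊆ V)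
    (g : ↥(Eset G U)) :
    psi G hUV (GGrp.gen G U g) = GGrp.gen G V ⟨(g : G), Eset_mono hUV g.2⟩ := rfl

/-- The evaluation homomorphism `ε_V : 𝐆(G,V) → G`. -/
def evalHom (G : Type*) {M : Type*} [Group G] [MulAction G M] (V : Set M) :
    GGrp G V →* G :=
  QuotientGroup.lift _ (FreeGroup.lift (fun g : ↥(Eset G V) => (g : G))) <| by
    intro x hx
    have hsub : relatorSet G V ⊆
        ((FreeGroup.lift (fun g : ↥(Eset G V) => (g : G))).ker :
          Set (FreeGroup ↥(Eset G V))) := by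
      rintro r ⟨g, h, gh, hF, hmul, rfl⟩
      have : FreeGroup.lift (fun g : ↥(Eset G V) => (g : G))
          (FreeGroup.of g * FreeGroup.of h * (FreeGroup.of gh)⁻¹) = 1 := by
        rw [map_mul, map_mul, map_inv, FreeGroup.lift_apply_of, FreeGroup.lift_apply_of,
          FreeGroup.lift_apply_of, hmul]
        group
      exact this
    exact (Subgroup.normalClosure_le_normal hsub) hx

@[simp] theorem evalHom_gen {G M : Type*} [Group G] [MulAction G M] (V : Set M)
    (g : ↥(Eset G V)) : evalHom G V (GGrp.gen G V g) = (g : G) := by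
  simp [evalHom, GGrp.gen, FreeGroup.lift_apply_of]


/-- For `U ⊆ V ⊆ W ⊆ M`: `E(U) ⊆ E(V) ⊆ E(W)`, `F'(U) ⊆ F'(V) ⊆ F'(W)`, the generator
assignment induces well-defined homomorphisms `ψ_U^V`, `ψ_V^W`, `ψ_U^W` (so that each sends
the class of a generator `g` to the class of `g`), and `ψ_U^W = ψ_V^W ∘ ψ_U^V`. -/
theorem psi_subset_comp {G M : Type*} [Group G] [MulAction G M] {U V W : Set M}
    (hUV : U ⊆ V) (hVW : V ⊆ W) :
    Eset G U ⊆ Eset G V ∧ Eset G V ⊆ Eset G W ∧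
    Fset G U ⊆ Fset G V ∧ Fset G V ⊆ Fset G W ∧
    (∀ g : ↥(Eset G U), psi G hUV (GGrp.gen G U g) = GGrp.gen G V ⟨(g : G), Eset_mono hUV g.2⟩) ∧
    (∀ g : ↥(Eset G V), psi G hVW (GGrp.gen G V g) = GGrp.gen G W ⟨(g : G), Eset_mono hVW g.2⟩) ∧
    (∀ g : ↥(Eset G U), psi G (hUV.trans hVW) (GGrp.gen G U g)
        = GGrp.gen G W ⟨(g : G), Eset_mono (hUV.trans hVW) g.2⟩) ∧
    psi G (hUV.trans hVW) = (psi G hVW).comp (psi G hUV) := by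
  refine ⟨Eset_mono hUV, Eset_mono hVW, Fset_mono hUV, Fset_mono hVW, psi_gen hUV, psi_gen hVW,
    psi_gen (hUV.trans hVW), ?_⟩
  apply QuotientGroup.monoidHom_ext
  ext g
  rfl
end

section
/- Let a group G act (globally) on a set M and let V ⊆ M be equipped with the induced partial action. If the subgroup of G generated by E(V) is all of G, then the homomorphism ψ_V^M : 𝐆(G,V) → 𝐆(G,M) is surjective. -/
open Pointwise

theorem mem_Eset_univ {G M : Type*} [Group G] [MulAction G M] [Nonempty M] (g : G) :
    g ∈ Eset G (Set.univ : Set M) := by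
  simp [Eset]

theorem mem_Fset_univ {G M : Type*} [Group G] [MulAction G M] [Nonempty M] (p : G × G) :
    p ∈ Fset G (Set.univ : Set M) := by
  simp [Fset]

theorem GGrp.gen_mul_gen {G M : Type*} [Group G] [MulAction G M] {V : Set M}
    {g h gh : ↥(Eset G V)} (hF : ((g : G), (h : G)) ∈ Fset G V) (hmul : (gh : G) = g * h) :
    GGrp.gen G V g * GGrp.gen G V h = GGrp.gen G V gh := by
  rw [← mul_inv_eq_one]
  exact (QuotientGroup.eq_one_iff _).mpr
    (Subgroup.subset_normalClosure ⟨g, h, gh, hF, hmul, rfl⟩)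

theorem GGrp.closure_range_gen (G : Type*) {M : Type*} [Group G] [MulAction G M] (V : Set M) :
    Subgroup.closure (Set.range (GGrp.gen G V)) = ⊤ := by
  have h : Set.range (GGrp.gen G V) =
      QuotientGroup.mk' (Subgroup.normalClosure (relatorSet G V)) '' Set.range FreeGroup.of := by
    rw [← Set.range_comp]
    rfl
  rw [h, ← MonoidHom.map_closure, FreeGroup.closure_range_of,
    Subgroup.map_top_of_surjective _ (QuotientGroup.mk'_surjective _)]

/-- When `M` is nonempty, `E(M) = G` and `g ↦ (g)` is a homomorphism `G → 𝐆(G,M)`. -/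
def GGrp.genHom (G M : Type*) [Group G] [MulAction G M] [Nonempty M] :
    G →* GGrp G (Set.univ : Set M) :=
  MonoidHom.mk' (fun g => GGrp.gen G Set.univ ⟨g, mem_Eset_univ g⟩) fun _ _ =>
    (GGrp.gen_mul_gen (mem_Fset_univ _) rfl).symm

/-- If `G` acts globally on `M`, `V ⊆ M` carries the induced partial action, and `E(V)`
generates `G`, then `ψ_V^M : 𝐆(G,V) → 𝐆(G,M)` is surjective. -/
theorem psi_surjective_of_Eset_generates {G M : Type*} [Group G] [MulAction G M] {V : Set M}
    (hgen : Subgroup.closure (Eset G V) = ⊤) :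
    Function.Surjective (psi G (Set.subset_univ V) : GGrp G V →* GGrp G (Set.univ : Set M)) := by
  rw [← MonoidHom.range_eq_top, ← top_le_iff, ← GGrp.closure_range_gen, Subgroup.closure_le]
  rintro _ ⟨g, rfl⟩
  have : Nonempty M := g.2.to_type
  have hle : Subgroup.closure (Eset G V) ≤
      (psi G (Set.subset_univ V)).range.comap (GGrp.genHom G M) := by
    rw [Subgroup.closure_le]
    intro k hk
    exact ⟨GGrp.gen G V ⟨k, hk⟩, rfl⟩
  exact hle (hgen ▸ Subgroup.mem_top (g : G))
end

section
/- Let H be a Hausdorff topological group which is connected and simply connected, let G be a dense subgroup of H acting on H by left translation, and let V ⊆ X ⊆ H where V is open, path-connected and a G-covering (⋃_{g∈G} gV = H). Then the homomorphism ψ_V^X : 𝐆(G,V) → 𝐆(G,X) is injective. -/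
open Pointwise

/-- In a covering space of a simply connected space, two joined points of a fibre agree. -/
theorem IsCoveringMap.eq_of_joined {E B : Type*} [TopologicalSpace E] [TopologicalSpace B]
    [SimplyConnectedSpace B] {p : E → B} (cov : IsCoveringMap p) {e e' : E}
    (hj : Joined e e') (h : p e = p e') : e = e' := by
  obtain ⟨Γ⟩ := hj
  have key := cov.monodromy_eq_of_map_eq (x := p e) (y := p e) (γ := .refl (p e))
    (ex := ⟨e, rfl⟩) (ey := ⟨e', h.symm⟩) (.mk Γ) (Subsingleton.elim _ _)
  rw [cov.monodromy_refl] at key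
  exact congrArg Subtype.val key

/-- Every point of a path-connected space lies below a point of the covering space which is
joined to a given one. -/
theorem IsCoveringMap.exists_joined {E B : Type*} [TopologicalSpace E] [TopologicalSpace B]
    [PathConnectedSpace B] {p : E → B} (cov : IsCoveringMap p) (e : E) (y : B) :
    ∃ e', p e' = y ∧ Joined e e' := by
  let γ := PathConnectedSpace.somePath (p e) y
  have h0 : (γ : C(unitInterval, B)) 0 = p e := γ.source
  refine ⟨cov.liftPath γ e h0 1, ?_, ⟨⟨cov.liftPath γ e h0, cov.liftPath_zero γ e h0, rfl⟩⟩⟩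
  exact (congrFun (cov.liftPath_lifts γ e h0) 1).trans γ.target

/-- The flat bundle on which the transition from the chart `i` to the chart `j` is left
multiplication by `c j i`. -/
noncomputable def FiberBundleCore.ofCocycle {B ι F : Type*} [TopologicalSpace B] [Group F]
    [TopologicalSpace F] [DiscreteTopology F] {U : ι → Set B} (hU : ∀ i, IsOpen (U i))
    (hcov : ∀ x, ∃ i, x ∈ U i) {c : ι → ι → F}
    (hc : ∀ i j k, (U i ∩ U j ∩ U k).Nonempty → c k j * c j i = c k i) :
    FiberBundleCore ι B F where
  baseSet := U
  isOpen_baseSet := hU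
  indexAt x := (hcov x).choose
  mem_baseSet_at x := (hcov x).choose_spec
  coordChange i j _ v := c j i * v
  coordChange_self i x hx v := by
    have h : c i i = 1 := by simpa using hc i i i ⟨x, ⟨hx, hx⟩, hx⟩
    rw [h, one_mul]
  continuousOn_coordChange i j :=
    ((continuous_of_discreteTopology (f := fun v : F => c j i * v)).comp
      continuous_snd).continuousOn
  coordChange_comp i j k x hx v := by rw [← mul_assoc, hc i j k ⟨x, hx⟩]

/-- On a simply connected space, a locally constant cocycle subordinate to a cover by
path-connected open sets is a coboundary. -/
theorem exists_eq_mul_of_cocycle {B ι F : Type*} [TopologicalSpace B] [SimplyConnectedSpace B]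
    [Group F] {U : ι → Set B} (hU : ∀ i, IsOpen (U i)) (hpc : ∀ i, IsPathConnected (U i))
    (hcov : ∀ x, ∃ i, x ∈ U i) {c : ι → ι → F}
    (hc : ∀ i j k, (U i ∩ U j ∩ U k).Nonempty → c k j * c j i = c k i) :
    ∃ a : ι → F, ∀ i j, (U i ∩ U j).Nonempty → a j = c j i * a i := by
  let _ : TopologicalSpace F := ⊥
  have : DiscreteTopology F := ⟨rfl⟩
  let Z := FiberBundleCore.ofCocycle hU hcov hc
  have cov : IsCoveringMap Z.proj := FiberBundle.isCoveringMap (F := F) (E := Z.Fiber)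
  obtain ⟨x₀⟩ : Nonempty B := inferInstance
  let e₀ : Z.TotalSpace := ⟨x₀, (1 : F)⟩
  let q : ι → B → F → Z.TotalSpace := fun i y v => ⟨y, c (Z.indexAt y) i * v⟩
  have q_joined : ∀ i v, ∀ y ∈ U i, ∀ z ∈ U i, Joined (q i y v) (q i z v) := by
    intro i v y hy z hz
    have hcont : ContinuousOn (fun y => q i y v) (U i) :=
      (Z.localTriv i).continuousOn_invFun.comp (f := fun y => (y, v)) (by fun_prop)
        fun y hy => (Z.mem_localTriv_target i (y, v)).2 hy
    exact (((hpc i).image' hcont).joinedIn _ ⟨y, hy, rfl⟩ _ ⟨z, hz, rfl⟩).joined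
  have exists_coord : ∀ i, ∃ v, ∀ y ∈ U i, Joined e₀ (q i y v) := by
    intro i
    obtain ⟨y, hy⟩ := (hpc i).nonempty
    obtain ⟨⟨y', w⟩, rfl, he⟩ := cov.exists_joined e₀ y
    change F at w
    refine ⟨(c (Z.indexAt y') i)⁻¹ * w, fun z hz => ?_⟩
    refine Joined.trans ?_ (q_joined i _ y' hy z hz)
    simpa only [q, mul_inv_cancel_left] using he
  choose a ha using exists_coord
  refine ⟨a, fun i j ⟨y, hyi, hyj⟩ => ?_⟩
  have h : q i y (a i) = q j y (a j) :=
    cov.eq_of_joined ((ha i y hyi).symm.trans (ha j y hyj)) rfl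
  have h' : c (Z.indexAt y) i * a i = c (Z.indexAt y) j * a j :=
    Bundle.TotalSpace.mk_inj.1 h
  rw [← hc i j _ ⟨y, ⟨hyi, hyj⟩, Z.mem_baseSet_at y⟩, mul_assoc] at h'
  exact (mul_left_cancel h').symm

theorem inv_mul_mem_Eset {G M : Type*} [Group G] [MulAction G M] {V : Set M} {i j : G}
    (h : (i • V ∩ j • V).Nonempty) : i⁻¹ * j ∈ Eset G V := by
  obtain ⟨x, hi, hj⟩ := h
  refine ⟨i⁻¹ • x, Set.mem_smul_set_iff_inv_smul_mem.1 hi, ?_⟩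
  rw [mul_smul]
  exact Set.smul_mem_smul_set hj

theorem GGrp.gen_mul {G M : Type*} [Group G] [MulAction G M] {V : Set M}
    (g h gh : ↥(Eset G V)) (hF : ((g : G), (h : G)) ∈ Fset G V) (hmul : (gh : G) = g * h) :
    GGrp.gen G V g * GGrp.gen G V h = GGrp.gen G V gh := by
  rw [← mul_inv_eq_one]
  exact (QuotientGroup.eq_one_iff _).2
    (Subgroup.subset_normalClosure ⟨g, h, gh, hF, hmul, rfl⟩)

/-- A function to `𝐆(G,V)` that translates right multiplication by `E(V)` into right
multiplication by generators does so for right multiplication by every value of `ε_V`. -/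
theorem GGrp.map_mul_evalHom {G M : Type*} [Group G] [MulAction G M] {V : Set M}
    (f : G → GGrp G V)
    (hf : ∀ i (g : ↥(Eset G V)), f (i * g) = f i * GGrp.gen G V g) (w : GGrp G V) (i : G) :
    f (i * evalHom G V w) = f i * w := by
  obtain ⟨w, rfl⟩ := QuotientGroup.mk_surjective w
  induction w using FreeGroup.induction_on generalizing i with
  | C1 => simp
  | of g =>
    change f (i * evalHom G V (GGrp.gen G V g)) = f i * GGrp.gen G V g
    rw [evalHom_gen, hf]
  | inv_of g _ =>
    change f (i * evalHom G V (GGrp.gen G V g)⁻¹) = f i * (GGrp.gen G V g)⁻¹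
    rw [map_inv, evalHom_gen, eq_mul_inv_iff_mul_eq, ← hf, inv_mul_cancel_right]
  | mul x y hx hy =>
    rw [QuotientGroup.mk_mul, map_mul, ← mul_assoc, hy, hx, mul_assoc]

open Classical in
/-- Macbeath's theorem: on a simply connected space, evaluation is injective on `𝐆(G,V)` if the
translates of the path-connected open set `V` cover the space. -/
theorem evalHom_injective_of_covering {G M : Type*} [Group G] [MulAction G M]
    [TopologicalSpace M] [ContinuousConstSMul G M] [SimplyConnectedSpace M] {V : Set M}
    (hVopen : IsOpen V) (hVpc : IsPathConnected V) (hcov : (⋃ g : G, g • V) = Set.univ) :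
    Function.Injective (evalHom G V) := by
  let c : G → G → GGrp G V := fun j i =>
    if h : j⁻¹ * i ∈ Eset G V then GGrp.gen G V ⟨j⁻¹ * i, h⟩ else 1
  have hc : ∀ i j k : G, (i • V ∩ j • V ∩ k • V).Nonempty → c k j * c j i = c k i := by
    rintro i j k ⟨x, ⟨hi, hj⟩, hk⟩
    have hkj : k⁻¹ * j ∈ Eset G V := inv_mul_mem_Eset ⟨x, hk, hj⟩
    have hji : j⁻¹ * i ∈ Eset G V := inv_mul_mem_Eset ⟨x, hj, hi⟩
    have hki : k⁻¹ * i ∈ Eset G V := inv_mul_mem_Eset ⟨x, hk, hi⟩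
    simp only [c, dif_pos hkj, dif_pos hji, dif_pos hki]
    refine GGrp.gen_mul _ _ _ ⟨k⁻¹ • x, ⟨Set.mem_smul_set_iff_inv_smul_mem.1 hk, ?_⟩, ?_⟩
      (by group)
    · simpa only [mul_smul] using Set.smul_mem_smul_set (a := k⁻¹) hj
    · simpa only [mul_smul, smul_inv_smul] using Set.smul_mem_smul_set (a := k⁻¹) hi
  obtain ⟨a, ha⟩ := exists_eq_mul_of_cocycle (U := fun g : G => g • V)
    (fun g => hVopen.smul g) (fun g => hVpc.image (continuous_const_smul g))
    (fun x => Set.mem_iUnion.1 (hcov ▸ Set.mem_univ x)) hc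
  have hstep : ∀ (i : G) (g : ↥(Eset G V)), (a (i * g))⁻¹ = (a i)⁻¹ * GGrp.gen G V g := by
    rintro i ⟨g, x, hx, hgx⟩
    have hne : ((i * g) • V ∩ i • V).Nonempty :=
      ⟨i • x, by simpa only [mul_smul] using Set.smul_mem_smul_set (a := i) hgx,
        Set.smul_mem_smul_set hx⟩
    have hci : c i (i * g) = GGrp.gen G V ⟨g, x, hx, hgx⟩ := by
      have hg : i⁻¹ * (i * g) ∈ Eset G V := by
        rw [inv_mul_cancel_left]
        exact ⟨x, hx, hgx⟩
      simp only [c, dif_pos hg, inv_mul_cancel_left]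
    rw [ha _ _ hne, hci, mul_inv_rev, inv_mul_cancel_right]
  intro w w' h
  have key := GGrp.map_mul_evalHom (fun i => (a i)⁻¹) hstep
  exact mul_left_cancel ((key w 1).symm.trans (h ▸ key w' 1))

theorem evalHom_comp_psi {G M : Type*} [Group G] [MulAction G M] {U V : Set M} (hUV : U ⊆ V) :
    (evalHom G V).comp (psi G hUV) = evalHom G U := by
  refine QuotientGroup.monoidHom_ext _ (FreeGroup.ext_hom _ _ fun g => ?_)
  change evalHom G V (psi G hUV (GGrp.gen G U g)) = evalHom G U (GGrp.gen G U g)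
  rw [psi_gen, evalHom_gen, evalHom_gen]

/-- Macbeath-type injectivity: if `H` is a Hausdorff, connected, simply connected topological
group, `G ≤ H` is dense, and `V ⊆ X ⊆ H` with `V` open, path-connected and a `G`-covering,
then `ψ_V^X : 𝐆(G,V) → 𝐆(G,X)` is injective. -/
theorem psi_injective_of_covering {H : Type*} [TopologicalSpace H] [Group H]
    [IsTopologicalGroup H] [T2Space H] [ConnectedSpace H] [SimplyConnectedSpace H]
    (G : Subgroup H) (hdense : Dense (G : Set H))
    {V X : Set H} (hVX : V ⊆ X)
    (hVopen : IsOpen V) (hVpc : IsPathConnected V)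
    (hcov : (⋃ g : ↥G, g • V) = (Set.univ : Set H)) :
    Function.Injective (psi ↥G hVX : GGrp ↥G V →* GGrp ↥G X) := by
  have hinj := evalHom_injective_of_covering hVopen hVpc hcov
  rw [← evalHom_comp_psi hVX] at hinj
  exact Function.Injective.of_comp hinj
end

section
/- Let H be a topological group, G a dense subgroup of H acting on H by left translation, and V ⊆ H an open subset; put V' = V ∩ G. Then E(V') = E(V) and F'(V') = F'(V); consequently the homomorphism ψ_{V'}^{V} : 𝐆(G,V') → 𝐆(G,V) is an isomorphism. -/
open Pointwise

/-- If shrinking `V` to `U` loses neither generators nor relators, then `ψ_U^V` is bijective. -/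
theorem psi_bijective_of_subset {G M : Type*} [Group G] [MulAction G M] {U V : Set M}
    (hUV : U ⊆ V) (hE : Eset G V ⊆ Eset G U) (hF : Fset G V ⊆ Fset G U) :
    Function.Bijective (psi G hUV) := by
  let φ : FreeGroup ↥(Eset G V) →* GGrp G U :=
    FreeGroup.lift fun g => GGrp.gen G U ⟨(g : G), hE g.2⟩
  have hφ : Subgroup.normalClosure (relatorSet G V) ≤ φ.ker := by
    refine Subgroup.normalClosure_le_normal ?_
    rintro r ⟨g, h, gh, hgh, hmul, rfl⟩
    refine (MonoidHom.mem_ker).mpr ?_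
    simp only [φ, map_mul, map_inv, FreeGroup.lift_apply_of]
    exact (QuotientGroup.eq_one_iff _).mpr
      (Subgroup.subset_normalClosure ⟨_, _, _, hF hgh, hmul, rfl⟩)
  let χ : GGrp G V →* GGrp G U := QuotientGroup.lift _ φ hφ
  have hχ (g : ↥(Eset G V)) : χ (GGrp.gen G V g) = GGrp.gen G U ⟨(g : G), hE g.2⟩ :=
    FreeGroup.lift_apply_of
  have hleft : χ.comp (psi G hUV) = MonoidHom.id _ := by
    refine QuotientGroup.monoidHom_ext _ (FreeGroup.ext_hom _ _ fun g => ?_)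
    exact (congrArg χ (psi_gen hUV g)).trans (hχ _)
  have hright : (psi G hUV).comp χ = MonoidHom.id _ := by
    refine QuotientGroup.monoidHom_ext _ (FreeGroup.ext_hom _ _ fun g => ?_)
    exact (congrArg (psi G hUV) (hχ g)).trans (psi_gen hUV _)
  exact Function.bijective_iff_has_inverse.mpr
    ⟨χ, DFunLike.congr_fun hleft, DFunLike.congr_fun hright⟩

/-- Intersecting with a subgroup `G` commutes with left translation by elements of `G`. -/
theorem smul_set_inter_subgroup {H : Type*} [Group H] (G : Subgroup H) (g : G) (V : Set H) :
    g • (V ∩ (G : Set H)) = g • V ∩ (G : Set H) := by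
  ext x
  simp only [Set.mem_smul_set_iff_inv_smul_mem, Set.mem_inter_iff, SetLike.mem_coe,
    Subgroup.smul_def, smul_eq_mul]
  exact and_congr_right fun _ => G.mul_mem_cancel_left (g⁻¹).2

/-- If `G` is a dense subgroup of a topological group `H` acting by left translation and
`V ⊆ H` is open, then with `V' = V ∩ G` we have `E(V') = E(V)`, `F'(V') = F'(V)` and
`ψ_{V'}^{V} : 𝐆(G,V') → 𝐆(G,V)` is an isomorphism. -/
theorem psi_inter_dense_iso {H : Type*} [TopologicalSpace H] [Group H] [IsTopologicalGroup H]
    (G : Subgroup H) (hdense : Dense (G : Set H))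
    (V : Set H) (hVopen : IsOpen V) :
    Eset ↥G (V ∩ (G : Set H)) = Eset ↥G V ∧
    Fset ↥G (V ∩ (G : Set H)) = Fset ↥G V ∧
    Function.Bijective
      (psi ↥G (Set.inter_subset_left : V ∩ (G : Set H) ⊆ V)) := by
  have hE : Eset ↥G V ⊆ Eset ↥G (V ∩ (G : Set H)) := by
    intro g hg
    obtain ⟨x, ⟨hx, hgx⟩, hxG⟩ :=
      hdense.inter_open_nonempty _ (hVopen.inter (hVopen.smul g)) hg
    refine ⟨x, ⟨hx, hxG⟩, ?_⟩
    rw [smul_set_inter_subgroup]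
    exact ⟨hgx, hxG⟩
  have hF : Fset ↥G V ⊆ Fset ↥G (V ∩ (G : Set H)) := by
    intro p hp
    obtain ⟨x, ⟨⟨hx, hgx⟩, hghx⟩, hxG⟩ :=
      hdense.inter_open_nonempty _
        ((hVopen.inter (hVopen.smul p.1)).inter (hVopen.smul (p.1 * p.2))) hp
    refine ⟨x, ⟨⟨hx, hxG⟩, ?_⟩, ?_⟩ <;> rw [smul_set_inter_subgroup]
    exacts [⟨hgx, hxG⟩, ⟨hghx, hxG⟩]
  exact ⟨(Eset_mono Set.inter_subset_left).antisymm hE,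
    (Fset_mono Set.inter_subset_left).antisymm hF,
    psi_bijective_of_subset _ hE hF⟩
end
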